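/- Let q be a real number with q > 1 and let N be a nonnegative integer. For integers 0 ≤ i < m define D(m,i) = −[m choose i]_q · ∏_{j=i}^{m−1} (q^j + 1). Suppose X : ℕ → ℝ satisfies, for every m ≥ 0, the recursion X(m) = q^{2mN} + Σ_{i=0}^{m−1} D(m,i)·X(i). Then for every m ≥ 0 one has X(m) = Σ_{i=0}^{m} (−1)^{m−i} · q^{(m−i)(m−i−1)/2} · [m choose i]_q · (∏_{j=i}^{m−1} (q^j + 1)) · q^{2iN}. -/

import Mathlib

/-- The Gaussian binomial coefficient `[n choose k]_q` for a real base `q`. -/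
noncomputable def gbinom (q : ℝ) (n k : ℕ) : ℝ :=
  ∏ j ∈ Finset.Icc 1 k, (q ^ (n - k + j) - 1) / (q ^ j - 1)

/-- The unnormalised `q`-factorial `∏_{j=1}^{n} (q^j - 1)`. -/
noncomputable def qFactorial (q : ℝ) (n : ℕ) : ℝ :=
  ∏ j ∈ Finset.range n, (q ^ (j + 1) - 1)

lemma qFactorial_succ (q : ℝ) (n : ℕ) :
    qFactorial q (n + 1) = qFactorial q n * (q ^ (n + 1) - 1) :=
  Finset.prod_range_succ _ _

lemma pow_succ_sub_one_ne_zero {q : ℝ} (hq : 1 < q) (n : ℕ) : q ^ (n + 1) - 1 ≠ 0 :=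
  (sub_pos.2 (one_lt_pow₀ hq n.succ_ne_zero)).ne'

lemma qFactorial_ne_zero {q : ℝ} (hq : 1 < q) (n : ℕ) : qFactorial q n ≠ 0 :=
  Finset.prod_ne_zero_iff.2 fun j _ => pow_succ_sub_one_ne_zero hq j

lemma gbinom_add {q : ℝ} (hq : 1 < q) (d k : ℕ) :
    gbinom q (d + k) k = qFactorial q (d + k) / (qFactorial q k * qFactorial q d) := by
  have h : gbinom q (d + k) k =
      (∏ j ∈ Finset.range k, (q ^ (d + j + 1) - 1)) / qFactorial q k := by
    rw [gbinom, qFactorial, ← Finset.prod_div_distrib, ← Finset.Ico_add_one_right_eq_Icc,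
      Finset.prod_Ico_eq_prod_range]
    refine Finset.prod_congr (by simp) fun j _ => ?_
    rw [Nat.add_sub_cancel, add_comm 1 j, add_assoc]
  have h' : qFactorial q (d + k) =
      qFactorial q d * ∏ j ∈ Finset.range k, (q ^ (d + j + 1) - 1) :=
    Finset.prod_range_add _ _ _
  have hd := qFactorial_ne_zero hq d
  have hk := qFactorial_ne_zero hq k
  rw [h, h']
  field_simp

lemma gbinom_zero_right (q : ℝ) (n : ℕ) : gbinom q n 0 = 1 := by
  simp [gbinom]

lemma gbinom_self {q : ℝ} (hq : 1 < q) (n : ℕ) : gbinom q n n = 1 := by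
  have h := gbinom_add hq 0 n
  rwa [zero_add, show qFactorial q 0 = 1 from Finset.prod_range_zero _, mul_one,
    div_self (qFactorial_ne_zero hq n)] at h

/-- The `q`-Pascal rule. -/
lemma gbinom_succ_succ {q : ℝ} (hq : 1 < q) {n k : ℕ} (h : k + 1 ≤ n) :
    gbinom q (n + 1) (k + 1) = gbinom q n k + q ^ (k + 1) * gbinom q n (k + 1) := by
  obtain ⟨d, rfl⟩ := Nat.exists_eq_add_of_le' h
  have h₁ := gbinom_add hq (d + 1) (k + 1)
  have h₂ := gbinom_add hq (d + 1) k
  have h₃ := gbinom_add hq d (k + 1)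
  rw [show d + 1 + (k + 1) = d + (k + 1) + 1 by ring] at h₁
  rw [show d + 1 + k = d + (k + 1) by ring] at h₂
  have hd := qFactorial_ne_zero hq d
  have hk := qFactorial_ne_zero hq k
  have hd' := pow_succ_sub_one_ne_zero hq d
  have hk' := pow_succ_sub_one_ne_zero hq k
  rw [h₁, h₂, h₃, qFactorial_succ q (d + (k + 1)), qFactorial_succ q d, qFactorial_succ q k]
  field_simp
  ring

lemma gbinom_mul_gbinom {q : ℝ} (hq : 1 < q) (k l d : ℕ) :
    gbinom q (d + l + k) (k + l) * gbinom q (k + l) k =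
      gbinom q (d + l + k) k * gbinom q (d + l) l := by
  have h₁ := gbinom_add hq d (k + l)
  have h₂ := gbinom_add hq l k
  rw [show d + (k + l) = d + l + k by ring] at h₁
  rw [show l + k = k + l by ring] at h₂
  rw [h₁, h₂, gbinom_add hq (d + l) k, gbinom_add hq d l]
  have := qFactorial_ne_zero hq d
  have := qFactorial_ne_zero hq k
  have := qFactorial_ne_zero hq l
  have := qFactorial_ne_zero hq (k + l)
  have := qFactorial_ne_zero hq (d + l)
  field_simp

lemma sum_neg_one_pow_mul_gbinom_partial {q : ℝ} (hq : 1 < q) (n L : ℕ) (hL : L ≤ n) :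
    ∑ l ∈ Finset.range (L + 1), (-1 : ℝ) ^ l * q ^ (l * (l - 1) / 2) * gbinom q (n + 1) l =
      (-1) ^ L * q ^ ((L + 1) * L / 2) * gbinom q n L := by
  induction L with
  | zero => simp [gbinom_zero_right]
  | succ L ih =>
    have hexp : (L + 1 + 1) * (L + 1) / 2 = (L + 1) * L / 2 + (L + 1) := by
      rw [show (L + 1 + 1) * (L + 1) = (L + 1) * L + (L + 1) * 2 by ring,
        Nat.add_mul_div_right _ _ two_pos]
    rw [Finset.sum_range_succ, ih (by omega), gbinom_succ_succ hq hL, hexp,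
      Nat.add_sub_cancel]
    ring

lemma sum_neg_one_pow_mul_gbinom {q : ℝ} (hq : 1 < q) (n : ℕ) :
    ∑ l ∈ Finset.range (n + 1), (-1 : ℝ) ^ l * q ^ (l * (l - 1) / 2) * gbinom q n l =
      if n = 0 then 1 else 0 := by
  cases n with
  | zero => simp [gbinom_zero_right]
  | succ n =>
    rw [Finset.sum_range_succ, sum_neg_one_pow_mul_gbinom_partial hq n n le_rfl,
      gbinom_self hq, gbinom_self hq, Nat.add_sub_cancel, if_neg n.succ_ne_zero]
    ring

/-- Gaussian inversion, twisted by a multiplicative weight `∏_{j=i}^{m-1} w j`. -/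
lemma sum_gbinom_mul_inversion {q : ℝ} (hq : 1 < q) (w a : ℕ → ℝ) (m : ℕ) :
    ∑ i ∈ Finset.range (m + 1), gbinom q m i * (∏ j ∈ Finset.Ico i m, w j) *
      ∑ k ∈ Finset.range (i + 1), (-1 : ℝ) ^ (i - k) * q ^ ((i - k) * (i - k - 1) / 2) *
        gbinom q i k * (∏ j ∈ Finset.Ico k i, w j) * a k = a m := by
  simp_rw [Finset.mul_sum]
  rw [Finset.sum_comm' (t' := Finset.range (m + 1)) (s' := fun k => Finset.Ico k (m + 1))
    (by intro i k; simp only [Finset.mem_range, Finset.mem_Ico]; omega)]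
  have inner : ∀ k ∈ Finset.range (m + 1),
      ∑ i ∈ Finset.Ico k (m + 1), gbinom q m i * (∏ j ∈ Finset.Ico i m, w j) *
        ((-1 : ℝ) ^ (i - k) * q ^ ((i - k) * (i - k - 1) / 2) *
          gbinom q i k * (∏ j ∈ Finset.Ico k i, w j) * a k) =
      if k = m then a k else 0 := by
    intro k hk
    obtain ⟨n, rfl⟩ := Nat.exists_eq_add_of_le' (Finset.mem_range_succ_iff.1 hk)
    have key : ∀ l ∈ Finset.range (n + 1),
        gbinom q (n + k) (k + l) * (∏ j ∈ Finset.Ico (k + l) (n + k), w j) *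
          ((-1 : ℝ) ^ (k + l - k) * q ^ ((k + l - k) * (k + l - k - 1) / 2) *
            gbinom q (k + l) k * (∏ j ∈ Finset.Ico k (k + l), w j) * a k) =
        gbinom q (n + k) k * (∏ j ∈ Finset.Ico k (n + k), w j) * a k *
          ((-1 : ℝ) ^ l * q ^ (l * (l - 1) / 2) * gbinom q n l) := by
      intro l hl
      obtain ⟨d, rfl⟩ := Nat.exists_eq_add_of_le' (Finset.mem_range_succ_iff.1 hl)
      rw [Nat.add_sub_cancel_left, ← Finset.prod_Ico_consecutive w (Nat.le_add_right k l)
        (show k + l ≤ d + l + k by omega)]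
      linear_combination (∏ j ∈ Finset.Ico k (k + l), w j) *
        (∏ j ∈ Finset.Ico (k + l) (d + l + k), w j) * a k * (-1 : ℝ) ^ l *
        q ^ (l * (l - 1) / 2) * gbinom_mul_gbinom hq k l d
    rw [Finset.sum_Ico_eq_sum_range, show n + k + 1 - k = n + 1 by omega,
      Finset.sum_congr rfl key, ← Finset.mul_sum, sum_neg_one_pow_mul_gbinom hq]
    rcases Nat.eq_zero_or_pos n with rfl | hn
    · simp [gbinom_self hq]
    · rw [if_neg hn.ne', if_neg (by omega), mul_zero]
  rw [Finset.sum_congr rfl inner]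
  simp

theorem stmt4 (q : ℝ) (hq : 1 < q) (N : ℕ) (X : ℕ → ℝ)
    (hX : ∀ m : ℕ, X m = q ^ (2 * m * N) +
      ∑ i ∈ Finset.range m,
        (-(gbinom q m i * ∏ j ∈ Finset.Ico i m, (q ^ j + 1))) * X i) :
    ∀ m : ℕ, X m = ∑ i ∈ Finset.range (m + 1),
      (-1 : ℝ) ^ (m - i) * q ^ ((m - i) * (m - i - 1) / 2) * gbinom q m i *
        (∏ j ∈ Finset.Ico i m, (q ^ j + 1)) * q ^ (2 * i * N) := by
  intro m
  induction m using Nat.strong_induction_on with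
  | _ m ih =>
    have h := sum_gbinom_mul_inversion hq (fun j => q ^ j + 1) (fun i => q ^ (2 * i * N)) m
    rw [Finset.sum_range_succ, gbinom_self hq, Finset.Ico_self, Finset.prod_empty, one_mul,
      one_mul, ← Finset.sum_congr rfl fun i hi => congrArg _ (ih i (Finset.mem_range.1 hi))] at h
    rw [hX m]
    simp only [neg_mul, Finset.sum_neg_distrib]
    linarith
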